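/- Let 1 ≤ b < n/2 − 1 and let T be an n-vertex chemical tree with exactly b branching vertices such that M2(T') ≤ M2(T) for every n-vertex chemical tree T' with exactly b branching vertices. If T contains a pendent vertex adjacent to a branching vertex, then T does not contain any pendent path of length greater than 2. -/

import Mathlib

open SimpleGraph

namespace ChemTree

variable {V : Type*}

/-- The degree of a vertex. -/
noncomputable def deg (G : SimpleGraph V) (v : V) : ℕ :=
  (G.neighborSet v).ncard

/-- A chemical tree: a tree in which every vertex has degree at most 4. -/
def IsChemicalTree (G : SimpleGraph V) : Prop :=
  G.IsTree ∧ ∀ v, deg G v ≤ 4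

/-- `nDeg G i` is the number of vertices of `G` having degree `i`. -/
noncomputable def nDeg (G : SimpleGraph V) (i : ℕ) : ℕ :=
  {v | deg G v = i}.ncard

/-- The first Zagreb index. -/
noncomputable def M1 (G : SimpleGraph V) [Fintype V] : ℕ :=
  ∑ v, (deg G v) ^ 2

/-- The second Zagreb index. -/
noncomputable def M2 (G : SimpleGraph V) [Fintype V] : ℕ :=
  ∑ e ∈ (Set.toFinite G.edgeSet).toFinset,
    Sym2.lift ⟨fun u w => deg G u * deg G w, fun u w => Nat.mul_comm _ _⟩ e

/-- A segment: a nontrivial path whose end vertices have degree `≠ 2` and whose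
internal vertices all have degree `2`. -/
def IsSegment (G : SimpleGraph V) {u v : V} (p : G.Walk u v) : Prop :=
  p.IsPath ∧ 0 < p.length ∧ deg G u ≠ 2 ∧ deg G v ≠ 2 ∧
    ∀ w ∈ p.support, w ≠ u → w ≠ v → deg G w = 2

/-- The number of segments: in a tree, a segment is uniquely determined by the
unordered pair of its end vertices. -/
noncomputable def numSegments (G : SimpleGraph V) : ℕ :=
  {s : Sym2 V | ∃ (u v : V) (p : G.Walk u v), s = s(u, v) ∧ IsSegment G p}.ncard

/-- The number of branching vertices (vertices of degree at least 3). -/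
noncomputable def numBranching (G : SimpleGraph V) : ℕ :=
  {v | 3 ≤ deg G v}.ncard

/-- An internal path: both end vertices are branching and all internal vertices
have degree `2`. -/
def IsInternalPath (G : SimpleGraph V) {u v : V} (p : G.Walk u v) : Prop :=
  p.IsPath ∧ 0 < p.length ∧ 3 ≤ deg G u ∧ 3 ≤ deg G v ∧
    ∀ w ∈ p.support, w ≠ u → w ≠ v → deg G w = 2

/-- A pendent path: one end vertex is pendent, the other is branching and all
internal vertices have degree `2`. -/
def IsPendentPath (G : SimpleGraph V) {u v : V} (p : G.Walk u v) : Prop :=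
  p.IsPath ∧ 0 < p.length ∧ deg G u = 1 ∧ 3 ≤ deg G v ∧
    ∀ w ∈ p.support, w ≠ u → w ≠ v → deg G w = 2

end ChemTree

open ChemTree

namespace ChemTree

variable {V : Type*}

/-- The graph obtained from `G` by moving the vertex `u` from its neighbour `a` to `x`. -/
def moveLeaf (G : SimpleGraph V) (u a x : V) : SimpleGraph V :=
  G.deleteEdges {s(u, a)} ⊔ edge u x

variable {G : SimpleGraph V} {u a x c y : V}

lemma moveLeaf_adj (hux : u ≠ x) {p q : V} :
    (moveLeaf G u a x).Adj p q ↔ (G.Adj p q ∧ s(p, q) ≠ s(u, a)) ∨ s(p, q) = s(u, x) := by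
  simp only [moveLeaf, sup_adj, deleteEdges_adj, edge_adj, Set.mem_singleton_iff]
  grind

lemma adj_iff_of_neighborSet_eq_singleton (hu : G.neighborSet u = {a}) {w : V} :
    G.Adj u w ↔ w = a := by
  rw [← mem_neighborSet, hu, Set.mem_singleton_iff]

lemma deg_moveLeaf_of_ne {w : V} (hu : G.neighborSet u = {a}) (hux : u ≠ x)
    (hwa : w ≠ a) (hwx : w ≠ x) : deg (moveLeaf G u a x) w = deg G w := by
  have hu' (w) := adj_iff_of_neighborSet_eq_singleton hu (w := w)
  by_cases hwu : w = u
  · subst hwu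
    have : (moveLeaf G w a x).neighborSet w = {x} := by
      ext z
      simp only [mem_neighborSet, moveLeaf_adj hux, Set.mem_singleton_iff, hu']
      grind
    simp [deg, this, hu]
  · have : (moveLeaf G u a x).neighborSet w = G.neighborSet w := by
      ext z
      simp only [mem_neighborSet, moveLeaf_adj hux]
      grind
    rw [deg, deg, this]

lemma deg_moveLeaf_source (ha : G.neighborSet a = {u, c}) (hcu : c ≠ u) (hux : u ≠ x)
    (hxa : x ≠ a) : deg (moveLeaf G u a x) a = 1 := by
  have ha' (w) : G.Adj a w ↔ w = u ∨ w = c := by rw [← mem_neighborSet, ha]; simp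
  have : (moveLeaf G u a x).neighborSet a = {c} := by
    ext z
    simp only [mem_neighborSet, moveLeaf_adj hux, Set.mem_singleton_iff, ha']
    have := ha' a
    grind [SimpleGraph.irrefl]
  rw [deg, this, Set.ncard_singleton]

lemma deg_moveLeaf_target (hx : G.neighborSet x = {y}) (hyu : y ≠ u) (hux : u ≠ x)
    (hxa : x ≠ a) : deg (moveLeaf G u a x) x = 2 := by
  have hx' (w) := adj_iff_of_neighborSet_eq_singleton hx (w := w)
  have : (moveLeaf G u a x).neighborSet x = {u, y} := by
    ext z
    simp only [mem_neighborSet, moveLeaf_adj hux, hx', Set.mem_insert_iff, Set.mem_singleton_iff]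
    grind
  rw [deg, this, Set.ncard_pair hyu.symm]

lemma isTree_moveLeaf [Finite V] (hG : G.IsTree) (hu : G.neighborSet u = {a}) (hux : u ≠ x) :
    (moveLeaf G u a x).IsTree := by
  have hu' (w) := adj_iff_of_neighborSet_eq_singleton hu (w := w)
  have hcon : (G.induce {u}ᶜ).Connected := by
    classical
    have := Fintype.ofFinite V
    refine hG.connected.induce_compl_singleton_of_degree_eq_one ?_
    rw [← card_neighborSet_eq_degree, ← Set.toFinset_card, ← Set.ncard_eq_toFinset_card', hu,
      Set.ncard_singleton]
  have hle : ∀ {p q}, (G.induce {u}ᶜ).Adj p q → (moveLeaf G u a x).Adj p.1 q.1 := by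
    rintro ⟨p, hp⟩ ⟨q, hq⟩ h
    rw [moveLeaf_adj hux]
    simp only [Set.mem_compl_iff, Set.mem_singleton_iff] at hp hq
    exact .inl ⟨h, by grind⟩
  have hreach (w : V) : (moveLeaf G u a x).Reachable w x := by
    by_cases hw : w = u
    · subst hw
      exact ((moveLeaf_adj hux).2 (.inr rfl)).reachable
    · exact (hcon.preconnected ⟨w, hw⟩ ⟨x, hux.symm⟩).map ⟨Subtype.val, hle⟩
  have : Nonempty V := ⟨u⟩
  refine ⟨⟨fun v w => (hreach v).trans (hreach w).symm⟩, ?_⟩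
  refine IsAcyclic.sup_edge_of_not_reachable ?_ (hG.isAcyclic.anti (deleteEdges_le _))
  rintro ⟨p⟩
  cases p with
  | nil => exact hux rfl
  | cons h _ =>
    rw [deleteEdges_adj, hu'] at h
    exact h.2 (by rw [h.1]; rfl)

/-- The contribution of an edge to the second Zagreb index. -/
noncomputable def edgeWeight (G : SimpleGraph V) : Sym2 V → ℕ :=
  Sym2.lift ⟨fun u w => deg G u * deg G w, fun _ _ => Nat.mul_comm _ _⟩

lemma edgeWeight_mk (G : SimpleGraph V) (p q : V) : edgeWeight G s(p, q) = deg G p * deg G q := rfl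

lemma M2_lt_M2_moveLeaf [Fintype V] (hu : G.neighborSet u = {a}) (ha : G.neighborSet a = {u, c})
    (hx : G.neighborSet x = {y}) (hc : deg G c = 2) (hy : 3 ≤ deg G y) :
    M2 G < M2 (moveLeaf G u a x) := by
  classical
  have hu' (w) := adj_iff_of_neighborSet_eq_singleton hu (w := w)
  have hx' (w) := adj_iff_of_neighborSet_eq_singleton hx (w := w)
  have ha' (w) : G.Adj a w ↔ w = u ∨ w = c := by rw [← mem_neighborSet, ha]; simp
  have du : deg G u = 1 := by simp [deg, hu]
  have dx : deg G x = 1 := by simp [deg, hx]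
  have hcu : c ≠ u := by rintro rfl; omega
  have da : deg G a = 2 := by rw [deg, ha, Set.ncard_pair hcu.symm]
  have hyu : y ≠ u := by rintro rfl; omega
  have hya : y ≠ a := by rintro rfl; omega
  have hyx : y ≠ x := by rintro rfl; omega
  have hux : u ≠ x := by rintro rfl; exact hya (((hx' a).1 ((hu' a).2 rfl)).symm)
  have hxa : x ≠ a := by rintro rfl; omega
  have hua : u ≠ a := by rintro rfl; omega
  have hcx : c ≠ x := by rintro rfl; omega
  have hca : c ≠ a := ((ha' c).2 (.inr rfl)).ne'
  have da' : deg (moveLeaf G u a x) a = 1 := deg_moveLeaf_source ha hcu hux hxa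
  have dx' : deg (moveLeaf G u a x) x = 2 := deg_moveLeaf_target hx hyu hux hxa
  have dw {w} (hwa : w ≠ a) (hwx : w ≠ x) : deg (moveLeaf G u a x) w = deg G w :=
    deg_moveLeaf_of_ne hu hux hwa hwx
  set R : Finset (Sym2 V) :=
    (Set.toFinite (G.edgeSet \ {s(u, a), s(a, c), s(x, y)})).toFinset with hR
  have hE : (Set.toFinite G.edgeSet).toFinset =
      insert s(u, a) (insert s(a, c) (insert s(x, y) R)) := by
    ext e
    induction e with | _ p q => ?_
    have h1 := (hu' a).2 rfl
    have h2 := (ha' c).2 (.inr rfl)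
    have h3 := (hx' y).2 rfl
    simp only [hR, Set.Finite.mem_toFinset, mem_edgeSet, Finset.mem_insert, Set.mem_sdiff,
      Set.mem_insert_iff, Set.mem_singleton_iff]
    grind [SimpleGraph.adj_comm]
  have hE' : (Set.toFinite (moveLeaf G u a x).edgeSet).toFinset =
      insert s(u, x) (insert s(a, c) (insert s(x, y) R)) := by
    ext e
    induction e with | _ p q => ?_
    have h2 := (ha' c).2 (.inr rfl)
    have h3 := (hx' y).2 rfl
    simp only [hR, Set.Finite.mem_toFinset, mem_edgeSet, Finset.mem_insert, Set.mem_sdiff,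
      Set.mem_insert_iff, Set.mem_singleton_iff, moveLeaf_adj hux]
    grind [SimpleGraph.adj_comm]
  have hRw : ∑ e ∈ R, edgeWeight (moveLeaf G u a x) e = ∑ e ∈ R, edgeWeight G e := by
    refine Finset.sum_congr rfl fun e he => ?_
    induction e with | _ p q => ?_
    simp only [hR, Set.Finite.mem_toFinset, mem_edgeSet, Set.mem_sdiff, Set.mem_insert_iff,
      Set.mem_singleton_iff, not_or] at he
    have key {p q : V} (h : G.Adj p q) (h1 : s(p, q) ≠ s(u, a)) (h2 : s(p, q) ≠ s(a, c))
        (h3 : s(p, q) ≠ s(x, y)) : p ≠ a ∧ p ≠ x := by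
      constructor
      · rintro rfl
        rcases (ha' q).1 h with rfl | rfl
        exacts [h1 Sym2.eq_swap, h2 rfl]
      · rintro rfl
        exact h3 (by rw [(hx' q).1 h])
    obtain ⟨h, h1, h2, h3⟩ := he
    have hp := key h h1 h2 h3
    rw [Sym2.eq_swap] at h1 h2 h3
    have hq := key h.symm h1 h2 h3
    rw [edgeWeight_mk, edgeWeight_mk, dw hp.1 hp.2, dw hq.1 hq.2]
  have n1 : s(x, y) ∉ R := by simp [hR]
  have n2 : s(a, c) ∉ insert s(x, y) R := by simp [hR]; grind
  have n3 : s(u, a) ∉ insert s(a, c) (insert s(x, y) R) := by simp [hR]; grind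
  have n4 : s(u, x) ∉ insert s(a, c) (insert s(x, y) R) := by
    have : ¬ G.Adj u x := fun h => hxa ((hu' x).1 h)
    simp [hR, this]; grind
  change ∑ e ∈ _, edgeWeight G e < ∑ e ∈ _, edgeWeight (moveLeaf G u a x) e
  rw [hE, hE', Finset.sum_insert n3, Finset.sum_insert n4, Finset.sum_insert n2,
    Finset.sum_insert n2, Finset.sum_insert n1, Finset.sum_insert n1, hRw]
  simp only [edgeWeight_mk, da', dx', dw hua hux, dw hca hcx, dw hya hyx, du, da, dx, hc]
  omega

lemma neighborSet_eq_singleton_of_deg_eq_one (hu : deg G u = 1) (h : G.Adj u a) :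
    G.neighborSet u = {a} := by
  obtain ⟨z, hz⟩ := Set.ncard_eq_one.1 hu
  have : a ∈ G.neighborSet u := h
  rw [hz] at this ⊢
  rw [Set.mem_singleton_iff.1 this]

lemma neighborSet_eq_pair_of_deg_eq_two (ha : deg G a = 2) (hau : G.Adj a u) (hac : G.Adj a c)
    (huc : u ≠ c) : G.neighborSet a = {u, c} := by
  refine (Set.eq_of_subset_of_ncard_le ?_ ?_ (Set.finite_of_ncard_pos ?_)).symm
  · rintro z (rfl | rfl) <;> assumption
  · rw [Set.ncard_pair huc]; exact ha.le
  · exact Nat.two_pos.trans_eq ha.symm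

end ChemTree

theorem stmt_16 {V : Type*} [Fintype V] (n b : ℕ)
    (hcard : Fintype.card V = n) (hb1 : 1 ≤ b) (hb2 : (b : ℚ) < (n : ℚ) / 2 - 1)
    (T : SimpleGraph V) (hT : IsChemicalTree T) (hbr : numBranching T = b)
    (hmax : ∀ T' : SimpleGraph V, IsChemicalTree T' → numBranching T' = b →
      M2 T' ≤ M2 T)
    (hpend : ∃ u v : V, deg T u = 1 ∧ 3 ≤ deg T v ∧ T.Adj u v) :
    ∀ (u v : V) (p : T.Walk u v), IsPendentPath T p → p.length ≤ 2 := by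
  rintro u v p ⟨hp, -, hu, -, hint⟩
  by_contra! hlen
  obtain ⟨x, y, hx, hy, hxy⟩ := hpend
  cases p with
  | nil => simp at hlen
  | @cons _ a _ hua q =>
    cases q with
    | nil => simp at hlen
    | @cons _ c _ hac r =>
      cases r with
      | nil => simp at hlen
      | @cons _ d _ hcd s =>
        simp only [Walk.cons_isPath_iff, Walk.support_cons, List.mem_cons, not_or] at hp
        have hv := s.end_mem_support
        have ha2 : deg T a = 2 := hint a (by simp) hua.ne' (by grind)
        have hc2 : deg T c = 2 := hint c (by simp) (by grind) (by grind)
        have hNu := neighborSet_eq_singleton_of_deg_eq_one hu hua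
        have hNa := neighborSet_eq_pair_of_deg_eq_two ha2 hua.symm hac (by grind)
        have hNx := neighborSet_eq_singleton_of_deg_eq_one hx hxy
        have hax : x ≠ a := by rintro rfl; omega
        have hyu : y ≠ u := by rintro rfl; omega
        have hux : u ≠ x := by
          rintro rfl
          have := (adj_iff_of_neighborSet_eq_singleton hNu).1 hxy
          subst this
          omega
        have dw {w} (hwa : w ≠ a) (hwx : w ≠ x) : deg (moveLeaf T u a x) w = deg T w :=
          deg_moveLeaf_of_ne hNu hux hwa hwx
        have da := deg_moveLeaf_source hNa (by grind) hux hax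
        have dx := deg_moveLeaf_target (a := a) hNx hyu hux hax
        refine (M2_lt_M2_moveLeaf hNu hNa hNx hc2 hy).not_ge
          (hmax _ ⟨isTree_moveLeaf hT.1 hNu hux, fun w => ?_⟩ ?_)
        · have := hT.2 w
          rcases eq_or_ne w a with rfl | hwa
          · omega
          rcases eq_or_ne w x with rfl | hwx
          · omega
          rwa [dw hwa hwx]
        · rw [← hbr, numBranching, numBranching]
          congr 1
          ext w
          simp only [Set.mem_ofPred_eq]
          rcases eq_or_ne w a with rfl | hwa
          · omega
          rcases eq_or_ne w x with rfl | hwx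
          · omega
          rw [dw hwa hwx]
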